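/- Let L be a Lagrangian subspace of V = ℝ^{2n_A} × ℝ^{2n_B} with the product symplectic form. Then dim L_A + n_B = dim L_B + n_A (equivalently n_A − dim L_A = n_B − dim L_B: the two local deficits agree). -/

import Mathlib

open scoped BigOperators

namespace EntTrim

/-- The standard symplectic form on `ℝ^(2m)`:
`σ(v, w) = Σ_{i=1}^m (v_{2i-1} * w_{2i} - v_{2i} * w_{2i-1})` (zero-based indexing). -/
def stdSymp (m : ℕ) (v w : Fin (2 * m) → ℝ) : ℝ :=
  ∑ i : Fin m,
    (v ⟨2 * (i : ℕ), by have := i.isLt; omega⟩ *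
        w ⟨2 * (i : ℕ) + 1, by have := i.isLt; omega⟩ -
      v ⟨2 * (i : ℕ) + 1, by have := i.isLt; omega⟩ *
        w ⟨2 * (i : ℕ), by have := i.isLt; omega⟩)

/-- The product symplectic form on `ℝ^(2nA) × ℝ^(2nB)`:
`σ((u_A,u_B),(w_A,w_B)) = σ_A(u_A,w_A) + σ_B(u_B,w_B)`. -/
def prodSymp (nA nB : ℕ) (u w : (Fin (2 * nA) → ℝ) × (Fin (2 * nB) → ℝ)) : ℝ :=
  stdSymp nA u.1 w.1 + stdSymp nB u.2 w.2

/-- The standard symplectic form as a bilinear form. -/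
def stdSympForm (m : ℕ) : LinearMap.BilinForm ℝ (Fin (2 * m) → ℝ) :=
  LinearMap.mk₂ ℝ (stdSymp m)
    (fun _ _ _ => by
      simp only [stdSymp, Pi.add_apply, ← Finset.sum_add_distrib]
      exact Finset.sum_congr rfl fun _ _ => by ring)
    (fun _ _ _ => by
      simp only [stdSymp, Pi.smul_apply, smul_eq_mul, Finset.mul_sum]
      exact Finset.sum_congr rfl fun _ _ => by ring)
    (fun _ _ _ => by
      simp only [stdSymp, Pi.add_apply, ← Finset.sum_add_distrib]
      exact Finset.sum_congr rfl fun _ _ => by ring)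
    (fun _ _ _ => by
      simp only [stdSymp, Pi.smul_apply, smul_eq_mul, Finset.mul_sum]
      exact Finset.sum_congr rfl fun _ _ => by ring)

@[simp]
lemma stdSympForm_apply (m : ℕ) (v w : Fin (2 * m) → ℝ) :
    stdSympForm m v w = stdSymp m v w := rfl

lemma stdSymp_zero_left (m : ℕ) (w : Fin (2 * m) → ℝ) : stdSymp m 0 w = 0 := by
  simp [stdSymp]

lemma stdSympForm_isAlt (m : ℕ) : (stdSympForm m).IsAlt := fun v => by
  simp only [stdSympForm_apply, stdSymp]
  exact Finset.sum_eq_zero fun _ _ => by ring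

lemma stdSympForm_separatingLeft (m : ℕ) : (stdSympForm m).SeparatingLeft := by
  intro v hv
  have h := hv fun k => if (k : ℕ) % 2 = 0 then
    -v ⟨2 * (k / 2) + 1, by omega⟩ else v ⟨2 * (k / 2), by omega⟩
  have half (i : ℕ) : (2 * i + 1) / 2 = i := by omega
  simp only [stdSympForm_apply, stdSymp, Nat.mul_mod_right, Nat.mul_add_mod, half,
    Nat.mul_div_cancel_left _ (Nat.succ_pos 1), if_true, Nat.one_mod, one_ne_zero, if_false,
    mul_neg, sub_neg_eq_add] at h
  rw [Finset.sum_eq_zero_iff_of_nonneg fun _ _ =>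
    add_nonneg (mul_self_nonneg _) (mul_self_nonneg _)] at h
  ext k
  have hk := h ⟨k / 2, by omega⟩ (Finset.mem_univ _)
  obtain ⟨h0, h1⟩ := mul_self_add_mul_self_eq_zero.mp hk
  rcases Nat.mod_two_eq_zero_or_one k with hp | hp
  · rw [show k = ⟨2 * (k / 2), by omega⟩ from Fin.ext (by simp; omega)]
    exact h0
  · rw [show k = ⟨2 * (k / 2) + 1, by omega⟩ from Fin.ext (by simp; omega)]
    exact h1

lemma stdSympForm_nondegenerate (m : ℕ) : (stdSympForm m).Nondegenerate :=
  (stdSympForm_isAlt m).isRefl.nondegenerate_iff_separatingLeft.mpr (stdSympForm_separatingLeft m)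

/-- If `M` is orthogonal to the image of `L` under `p`, then
`dim L + dim M ≤ dim V + dim (L ⊓ ker p)`. -/
lemma finrank_add_finrank_le_of_map_orthogonal {K E V : Type*} [Field K]
    [AddCommGroup E] [Module K E] [FiniteDimensional K E]
    [AddCommGroup V] [Module K V] [FiniteDimensional K V]
    {B : LinearMap.BilinForm K V} (hB : B.Nondegenerate) (p : E →ₗ[K] V)
    (L : Submodule K E) (M : Submodule K V) (h : ∀ w ∈ L, ∀ u ∈ M, B u (p w) = 0) :
    Module.finrank K L + Module.finrank K M ≤
      Module.finrank K V + Module.finrank K (L ⊓ LinearMap.ker p : Submodule K E) := by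
  have hrank := (p.domRestrict L).finrank_range_add_finrank_ker
  rw [LinearMap.range_domRestrict, LinearMap.ker_domRestrict,
    ← Submodule.finrank_map_subtype_eq, Submodule.map_comap_subtype] at hrank
  have hle : L.map p ≤ B.orthogonal M := by
    rintro _ ⟨w, hw, rfl⟩ u hu
    exact h w hw u hu
  have := Submodule.finrank_mono hle
  rw [LinearMap.BilinForm.finrank_orthogonal hB] at this
  have := M.finrank_le
  omega

/-- For a Lagrangian subspace `L` of `ℝ^(2nA) × ℝ^(2nB)`, the two local deficits agree:
`dim L_A + nB = dim L_B + nA`. -/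
theorem local_deficits_agree (nA nB : ℕ)
    (L : Submodule ℝ ((Fin (2 * nA) → ℝ) × (Fin (2 * nB) → ℝ)))
    (hiso : ∀ u ∈ L, ∀ w ∈ L, prodSymp nA nB u w = 0)
    (hdim : Module.finrank ℝ L = nA + nB) :
    Module.finrank ℝ
        (Submodule.comap (LinearMap.inl ℝ (Fin (2 * nA) → ℝ) (Fin (2 * nB) → ℝ)) L) + nB =
      Module.finrank ℝ
        (Submodule.comap (LinearMap.inr ℝ (Fin (2 * nA) → ℝ) (Fin (2 * nB) → ℝ)) L) + nA := by
  have hA := finrank_add_finrank_le_of_map_orthogonal (stdSympForm_nondegenerate nA)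
    (LinearMap.fst ℝ _ _) L (L.comap (LinearMap.inl ℝ _ _)) fun w hw u hu => by
      simpa [prodSymp, stdSymp_zero_left] using hiso _ hu w hw
  have hB := finrank_add_finrank_le_of_map_orthogonal (stdSympForm_nondegenerate nB)
    (LinearMap.snd ℝ _ _) L (L.comap (LinearMap.inr ℝ _ _)) fun w hw u hu => by
      simpa [prodSymp, stdSymp_zero_left] using hiso _ hu w hw
  rw [← LinearMap.range_inr, inf_comm, ← Submodule.map_comap_eq,
    ← (Submodule.equivMapOfInjective _ LinearMap.inr_injective _).finrank_eq] at hA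
  rw [← LinearMap.range_inl, inf_comm, ← Submodule.map_comap_eq,
    ← (Submodule.equivMapOfInjective _ LinearMap.inl_injective _).finrank_eq] at hB
  simp only [Module.finrank_fin_fun] at hA hB
  omega

end EntTrim
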